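/- Monotone convolution of probability measures is well defined: for all Borel probability measures μ, ν on ℝ there exists a unique Borel probability measure α on ℝ such that F_α(z) = F_μ(F_ν(z)) for all z ∈ ℍ. -/

import Mathlib

open MeasureTheory Filter Topology Set

/-- The Cauchy transform of a measure on ℝ, `G_μ(z) = ∫ 1/(z-x) dμ(x)`. -/
noncomputable def cauchyTransform (μ : Measure ℝ) (z : ℂ) : ℂ :=
  ∫ x, (z - (x : ℂ))⁻¹ ∂μ

/-- The F-transform of a measure on ℝ, `F_μ(z) = 1/G_μ(z)`. -/
noncomputable def Ftransform (μ : Measure ℝ) (z : ℂ) : ℂ :=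
  (cauchyTransform μ z)⁻¹

lemma sub_ofReal_ne_zero_of_im_pos {z : ℂ} (hz : 0 < z.im) (x : ℝ) : z - (x : ℂ) ≠ 0 := by
  intro h
  have := congrArg Complex.im h
  simp at this
  exact hz.ne' this

lemma norm_inv_sub_ofReal_le {z : ℂ} {c : ℝ} (hc : 0 < c) (hz : c ≤ z.im) (x : ℝ) :
    ‖(z - (x : ℂ))⁻¹‖ ≤ c⁻¹ := by
  rw [norm_inv]
  apply inv_anti₀ hc
  calc c ≤ (z - (x : ℂ)).im := by simpa using hz
    _ ≤ ‖z - (x : ℂ)‖ := Complex.im_le_norm _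

lemma continuous_inv_sub_ofReal {z : ℂ} (hz : 0 < z.im) :
    Continuous fun x : ℝ => (z - (x : ℂ))⁻¹ :=
  Continuous.inv₀ (by fun_prop) (sub_ofReal_ne_zero_of_im_pos hz)

lemma integrable_inv_sub_ofReal (μ : Measure ℝ) [IsFiniteMeasure μ] {z : ℂ} (hz : 0 < z.im) :
    Integrable (fun x : ℝ => (z - (x : ℂ))⁻¹) μ :=
  Integrable.of_bound (continuous_inv_sub_ofReal hz).aestronglyMeasurable z.im⁻¹
    (ae_of_all _ (norm_inv_sub_ofReal_le hz le_rfl))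

lemma im_inv_sub_ofReal (z : ℂ) (x : ℝ) :
    ((z - (x : ℂ))⁻¹).im = -(z.im * ‖(z - (x : ℂ))⁻¹‖ ^ 2) := by
  rw [Complex.inv_im, norm_inv, inv_pow, ← Complex.normSq_eq_norm_sq]
  simp [div_eq_mul_inv]

lemma im_cauchyTransform (μ : Measure ℝ) [IsFiniteMeasure μ] {z : ℂ} (hz : 0 < z.im) :
    (cauchyTransform μ z).im = -(z.im * ∫ x : ℝ, ‖(z - (x : ℂ))⁻¹‖ ^ 2 ∂μ) := by
  have h : ∫ x : ℝ, ((z - (x : ℂ))⁻¹).im ∂μ = (cauchyTransform μ z).im :=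
    integral_im (𝕜 := ℂ) (integrable_inv_sub_ofReal μ hz)
  simp_rw [← h, im_inv_sub_ofReal]
  rw [integral_neg, integral_const_mul]

lemma integrable_norm_inv_sub_ofReal_sq (μ : Measure ℝ) [IsFiniteMeasure μ] {z : ℂ}
    (hz : 0 < z.im) : Integrable (fun x : ℝ => ‖(z - (x : ℂ))⁻¹‖ ^ 2) μ :=
  Integrable.of_bound ((continuous_inv_sub_ofReal hz).norm.pow 2).aestronglyMeasurable (z.im⁻¹ ^ 2)
    (ae_of_all _ fun x => by
      rw [Real.norm_of_nonneg (by positivity)]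
      gcongr
      exact norm_inv_sub_ofReal_le hz le_rfl x)

lemma norm_cauchyTransform_sq_le (μ : Measure ℝ) [IsProbabilityMeasure μ] {z : ℂ}
    (hz : 0 < z.im) :
    ‖cauchyTransform μ z‖ ^ 2 ≤ ∫ x : ℝ, ‖(z - (x : ℂ))⁻¹‖ ^ 2 ∂μ := by
  set c := ∫ x : ℝ, ‖(z - (x : ℂ))⁻¹‖ ∂μ with hc
  have h1 : ‖cauchyTransform μ z‖ ≤ c := norm_integral_le_integral_norm _
  have i1 := (integrable_inv_sub_ofReal μ hz).norm
  have i2 := integrable_norm_inv_sub_ofReal_sq μ hz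
  have h2 : 0 ≤ ∫ x : ℝ, (‖(z - (x : ℂ))⁻¹‖ - c) ^ 2 ∂μ :=
    integral_nonneg fun x => sq_nonneg _
  have h3 : ∫ x : ℝ, (‖(z - (x : ℂ))⁻¹‖ - c) ^ 2 ∂μ =
      ∫ x : ℝ, ‖(z - (x : ℂ))⁻¹‖ ^ 2 ∂μ - c ^ 2 := by
    have : ∀ x : ℝ, (‖(z - (x : ℂ))⁻¹‖ - c) ^ 2 =
        ‖(z - (x : ℂ))⁻¹‖ ^ 2 - (2 * c) * ‖(z - (x : ℂ))⁻¹‖ + c ^ 2 := fun x => by ring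
    simp_rw [this]
    have i3 : Integrable (fun x : ℝ => ‖(z - (x : ℂ))⁻¹‖ ^ 2 - (2 * c) * ‖(z - (x : ℂ))⁻¹‖) μ :=
      i2.sub (i1.const_mul _)
    rw [integral_add i3 (integrable_const _),
      integral_sub i2 (i1.const_mul _), integral_const_mul, ← hc]
    simp
    ring
  have h4 : ‖cauchyTransform μ z‖ ^ 2 ≤ c ^ 2 := by gcongr
  linarith

lemma im_cauchyTransform_neg (μ : Measure ℝ) [IsProbabilityMeasure μ] {z : ℂ} (hz : 0 < z.im) :
    (cauchyTransform μ z).im < 0 := by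
  rw [im_cauchyTransform μ hz, neg_lt_zero]
  refine mul_pos hz ?_
  rw [integral_pos_iff_support_of_nonneg (fun x => sq_nonneg _)
    (integrable_norm_inv_sub_ofReal_sq μ hz)]
  have : Function.support (fun x : ℝ => ‖(z - (x : ℂ))⁻¹‖ ^ 2) = univ := by
    ext x
    simp [sub_ofReal_ne_zero_of_im_pos hz x]
  rw [this, measure_univ]
  exact one_pos

lemma cauchyTransform_ne_zero (μ : Measure ℝ) [IsProbabilityMeasure μ] {z : ℂ} (hz : 0 < z.im) :
    cauchyTransform μ z ≠ 0 := by
  intro h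
  simpa [h] using im_cauchyTransform_neg μ hz

lemma im_le_im_Ftransform (μ : Measure ℝ) [IsProbabilityMeasure μ] {z : ℂ} (hz : 0 < z.im) :
    z.im ≤ (Ftransform μ z).im := by
  have h0 : 0 < ‖cauchyTransform μ z‖ := norm_pos_iff.2 (cauchyTransform_ne_zero μ hz)
  rw [Ftransform, Complex.inv_im, Complex.normSq_eq_norm_sq, im_cauchyTransform μ hz, neg_neg,
    le_div_iff₀ (by positivity)]
  exact mul_le_mul_of_nonneg_left (norm_cauchyTransform_sq_le μ hz) hz.le

lemma tendsto_integral_inv_sub {μ : Measure ℝ} [IsFiniteMeasure μ] {s : ℕ → ℝ → ℝ}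
    (hsm : ∀ n, Measurable (s n)) (hs : ∀ x, Tendsto (fun n => s n x) atTop (𝓝 x))
    {w : ℕ → ℂ} {z : ℂ} (hz : 0 < z.im) (hw : Tendsto w atTop (𝓝 z)) :
    Tendsto (fun n => ∫ x, (w n - (s n x : ℂ))⁻¹ ∂μ) atTop (𝓝 (cauchyTransform μ z)) := by
  have him : ∀ᶠ n in atTop, z.im / 2 < (w n).im :=
    ((Complex.continuous_im.tendsto z).comp hw).eventually_const_lt (half_lt_self hz)
  refine tendsto_integral_filter_of_dominated_convergence (fun _ => (z.im / 2)⁻¹) ?_ ?_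
    (integrable_const _) ?_
  · refine Eventually.of_forall fun n => Measurable.aestronglyMeasurable ?_
    have := hsm n
    fun_prop
  · filter_upwards [him] with n hn
    exact ae_of_all _ fun x => norm_inv_sub_ofReal_le (half_pos hz) hn.le _
  · refine ae_of_all _ fun x => Tendsto.inv₀ ?_ (sub_ofReal_ne_zero_of_im_pos hz x)
    exact hw.sub ((Complex.continuous_ofReal.tendsto x).comp (hs x))

lemma tendsto_mul_I_mul_cauchyTransform (μ : Measure ℝ) [IsProbabilityMeasure μ] {w : ℝ → ℂ}
    (hw : ∀ y : ℝ, 0 < y → y ≤ (w y).im)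
    (hlim : Tendsto (fun y : ℝ => w y / (y * Complex.I)) atTop (𝓝 1)) :
    Tendsto (fun y : ℝ => y * Complex.I * cauchyTransform μ (w y)) atTop (𝓝 1) := by
  have hone : (1 : ℂ) = ∫ _ : ℝ, (1 : ℂ) ∂μ := by simp
  rw [hone]
  simp_rw [cauchyTransform, ← integral_const_mul]
  refine tendsto_integral_filter_of_dominated_convergence (fun _ => 1) ?_ ?_
    (integrable_const _) ?_
  · filter_upwards [eventually_gt_atTop 0] with y hy
    exact ((integrable_inv_sub_ofReal μ (hy.trans_le (hw y hy))).const_mul _).aestronglyMeasurable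
  · filter_upwards [eventually_gt_atTop 0] with y hy
    refine ae_of_all _ fun x => ?_
    have := norm_inv_sub_ofReal_le hy (hw y hy) x
    rw [norm_mul]
    calc ‖(y : ℂ) * Complex.I‖ * ‖(w y - (x : ℂ))⁻¹‖ ≤ y * y⁻¹ := by
          gcongr
          simp [abs_of_pos hy]
      _ = 1 := mul_inv_cancel₀ hy.ne'
  · refine ae_of_all _ fun x => ?_
    have h1 : Tendsto (fun y : ℝ => (x : ℂ) / (y * Complex.I)) atTop (𝓝 0) := by
      rw [tendsto_zero_iff_norm_tendsto_zero]
      have : Tendsto (fun y : ℝ => |x| / |y|) atTop (𝓝 0) :=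
        Tendsto.div_atTop tendsto_const_nhds tendsto_abs_atTop_atTop
      simpa using this
    have h2 := (hlim.sub h1).inv₀ (by simp)
    simp only [sub_zero, inv_one] at h2
    refine h2.congr fun y => ?_
    rw [← sub_div, inv_div, div_eq_mul_inv]

lemma tendsto_Ftransform_div (ν : Measure ℝ) [IsProbabilityMeasure ν] :
    Tendsto (fun y : ℝ => Ftransform ν (y * Complex.I) / (y * Complex.I)) atTop (𝓝 1) := by
  have h : Tendsto (fun y : ℝ => (y * Complex.I * cauchyTransform ν (y * Complex.I))⁻¹) atTop
      (𝓝 1) := by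
    have := (tendsto_mul_I_mul_cauchyTransform ν (w := fun y => y * Complex.I) (by simp)
      (tendsto_const_nhds.congr' ?_)).inv₀ one_ne_zero
    · simpa only [inv_one] using this
    · filter_upwards [eventually_gt_atTop 0] with y hy
      rw [div_self]
      simp [hy.ne']
  refine h.congr fun y => ?_
  rw [mul_inv_rev, Ftransform, div_eq_mul_inv]

lemma Finset.isProbabilityMeasure_sum_smul {ι Ω : Type*} [MeasurableSpace Ω] (T : Finset ι)
    (c : ι → ENNReal) (hc : ∑ i ∈ T, c i = 1) (m : ι → Measure Ω)
    (hm : ∀ i, IsProbabilityMeasure (m i)) : IsProbabilityMeasure (∑ i ∈ T, c i • m i) :=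
  ⟨by simpa [Measure.finsetSum_apply] using hc⟩

lemma cauchyTransform_sum_smul {ι : Type*} (T : Finset ι) (c : ι → ENNReal)
    (hc : ∑ i ∈ T, c i = 1) (m : ι → Measure ℝ) (hm : ∀ i, IsProbabilityMeasure (m i)) {z : ℂ}
    (hz : 0 < z.im) :
    cauchyTransform (∑ i ∈ T, c i • m i) z = ∑ i ∈ T, (c i).toReal * cauchyTransform (m i) z := by
  have hfin : ∀ i ∈ T, c i ≠ ⊤ := fun i hi =>
    ((Finset.single_le_sum (fun _ _ => zero_le) hi).trans hc.le |>.trans_lt ENNReal.one_lt_top).ne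
  rw [cauchyTransform, integral_finsetSum_measure
    fun i hi => (integrable_inv_sub_ofReal (m i) hz).smul_measure (hfin i hi)]
  simp [cauchyTransform, integral_smul_measure]

lemma MeasureTheory.SimpleFunc.map_eq_sum_dirac {Ω : Type*} [MeasurableSpace Ω] (μ : Measure Ω)
    (s : SimpleFunc Ω ℝ) :
    μ.map s = ∑ y ∈ s.range, μ (s ⁻¹' {y}) • Measure.dirac y := by
  ext A hA
  rw [Measure.map_apply s.measurable hA]
  have h := SimpleFunc.map_lintegral (μ := μ) (A.indicator (fun _ => (1 : ENNReal))) s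
  rw [← SimpleFunc.lintegral_eq_lintegral] at h
  simp only [SimpleFunc.coe_map] at h
  have h2 : ∫⁻ x, (A.indicator (fun _ => (1 : ENNReal)) ∘ s) x ∂μ = μ (s ⁻¹' A) := by
    rw [← lintegral_indicator_one (s.measurable hA)]
    rfl
  rw [← h2, h]
  simp only [Measure.finsetSum_apply, Measure.smul_apply, Measure.dirac_apply' _ hA, smul_eq_mul]
  exact Finset.sum_congr rfl fun y _ => mul_comm _ _

lemma exists_cauchyTransform_rankOne_perturbation {ι : Type*} [Fintype ι] [DecidableEq ι]
    (q b : ι → ℝ) (hq : ∀ i, 0 ≤ q i) (hq1 : ∑ i, q i = 1) (a : ℝ) :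
    ∃ α : Measure ℝ, IsProbabilityMeasure α ∧ ∀ z : ℂ, 0 < z.im → ∀ G : ℂ,
      G = ∑ i, q i * (z - b i)⁻¹ → 1 - a * G ≠ 0 → cauchyTransform α z = G / (1 - a * G) := by
  let v : EuclideanSpace ℂ ι := WithLp.toLp 2 fun i => (√(q i) : ℂ)
  let A : Matrix ι ι ℂ := Matrix.of fun i j => (if i = j then (b i : ℂ) else 0) + a * (v i * v j)
  have hA : A.IsHermitian := by
    ext i j
    by_cases h : i = j
    · subst h
      simp [A, v]
    · simp [A, v, h, Ne.symm h, mul_comm]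
  have hT := Matrix.isSymmetric_toEuclideanLin_iff.mpr hA
  set u := hA.eigenvectorBasis
  set l := hA.eigenvalues
  have hu : ∀ k, Matrix.toEuclideanLin A (u k) = (l k : ℂ) • u k := by
    intro k
    ext i
    have := congrFun (hA.mulVec_eigenvectorBasis k) i
    simpa [Matrix.toLpLin_apply] using this
  have hv : ‖v‖ = 1 := by
    rw [EuclideanSpace.norm_eq, Real.sqrt_eq_one, ← hq1]
    refine Finset.sum_congr rfl fun i _ => ?_
    simp [v, Real.sq_sqrt (hq i)]
  have hv1 : ∑ k, ‖inner ℂ (u k) v‖ ^ 2 = 1 := by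
    rw [u.sum_sq_norm_inner_right, hv, one_pow]
  have hc : ∑ k, ENNReal.ofReal (‖inner ℂ (u k) v‖ ^ 2) = 1 := by
    rw [← ENNReal.ofReal_sum_of_nonneg fun _ _ => sq_nonneg _, hv1, ENNReal.ofReal_one]
  refine ⟨∑ k, ENNReal.ofReal (‖inner ℂ (u k) v‖ ^ 2) • Measure.dirac (l k),
    Finset.isProbabilityMeasure_sum_smul _ _ hc _ fun _ => inferInstance, ?_⟩
  intro z hz G hG hne
  rw [cauchyTransform_sum_smul _ _ hc _ (fun _ => inferInstance) hz]
  let w : EuclideanSpace ℂ ι :=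
    WithLp.toLp 2 fun i => (√(q i) : ℂ) * (z - b i)⁻¹ / (1 - a * G)
  have hsq : ∀ i, (√(q i) : ℂ) * √(q i) = q i := fun i => by
    rw [← Complex.ofReal_mul, Real.mul_self_sqrt (hq i)]
  have hvw : inner ℂ v w = G / (1 - a * G) := by
    rw [PiLp.inner_apply, hG, Finset.sum_div]
    refine Finset.sum_congr rfl fun i _ => ?_
    rw [← hsq i, ← hG]
    simp [v, w]
    ring
  have hw : z • w - Matrix.toEuclideanLin A w = v := by
    ext i
    have hb := sub_ofReal_ne_zero_of_im_pos hz (b i)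
    have h1 : Matrix.toEuclideanLin A w i = b i * w i + a * (v i * (G / (1 - a * G))) := by
      rw [← hvw, PiLp.inner_apply]
      simp [Matrix.toLpLin_apply, Matrix.mulVec, dotProduct, A, add_mul, Finset.sum_add_distrib,
        Finset.mul_sum]
      refine Finset.sum_congr rfl fun j _ => ?_
      simp [v]
      ring
    simp only [PiLp.sub_apply, PiLp.smul_apply, h1, smul_eq_mul]
    simp only [w, v]
    field_simp
    ring
  have hk : ∀ k, inner ℂ (u k) v = (z - l k) * inner ℂ (u k) w := by
    intro k
    rw [← hw, inner_sub_right, inner_smul_right, ← hT, hu, inner_smul_left]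
    simp
    ring
  rw [← hvw, ← u.sum_inner_mul_inner]
  refine Finset.sum_congr rfl fun k _ => ?_
  have hlk := sub_ofReal_ne_zero_of_im_pos hz (l k)
  rw [ENNReal.toReal_ofReal (sq_nonneg _)]
  have h2 : inner ℂ (u k) w = (z - l k)⁻¹ * inner ℂ (u k) v := by
    rw [hk k, inv_mul_cancel_left₀ hlk]
  rw [h2, ← inner_conj_symm v (u k), cauchyTransform, integral_dirac]
  push_cast
  rw [← Complex.conj_mul']
  ring

lemma exists_cauchyTransform_eq_comp_of_simpleFunc (μ ν : Measure ℝ) [IsProbabilityMeasure μ]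
    [IsProbabilityMeasure ν] (s t : SimpleFunc ℝ ℝ) :
    ∃ α : Measure ℝ, IsProbabilityMeasure α ∧ ∀ z : ℂ, 0 < z.im →
      cauchyTransform α z = cauchyTransform (μ.map s) (Ftransform (ν.map t) z) := by
  have sum_one : ∀ (ρ : Measure ℝ) [IsProbabilityMeasure ρ] (r : SimpleFunc ℝ ℝ),
      ∑ y ∈ r.range, ρ (r ⁻¹' {y}) = 1 := by
    intro ρ _ r
    rw [r.sum_range_measure_preimage_singleton, measure_univ]
  have : IsProbabilityMeasure (ν.map t) := Measure.isProbabilityMeasure_map t.measurable.aemeasurable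
  have key : ∀ a : ℝ, ∃ α : Measure ℝ, IsProbabilityMeasure α ∧ ∀ z : ℂ, 0 < z.im →
      cauchyTransform α z = (Ftransform (ν.map t) z - a)⁻¹ := by
    intro a
    obtain ⟨α, hα, h⟩ := exists_cauchyTransform_rankOne_perturbation
      (fun y : t.range => (ν (t ⁻¹' {y.1})).toReal) (fun y => y.1)
      (fun _ => ENNReal.toReal_nonneg) (by
        rw [← ENNReal.toReal_sum (fun _ _ => measure_ne_top _ _),
          Finset.sum_coe_sort t.range (fun y => ν (t ⁻¹' {y})), sum_one, ENNReal.toReal_one]) a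
    refine ⟨α, hα, fun z hz => ?_⟩
    have hG0 := cauchyTransform_ne_zero (ν.map t) hz
    have hFa := sub_ofReal_ne_zero_of_im_pos (hz.trans_le (im_le_im_Ftransform (ν.map t) hz)) a
    have hG : cauchyTransform (ν.map t) z =
        ∑ y : t.range, ((ν (t ⁻¹' {y.1})).toReal : ℂ) * (z - (y.1 : ℝ))⁻¹ := by
      rw [SimpleFunc.map_eq_sum_dirac, cauchyTransform_sum_smul _ _ (sum_one ν t) _
        (fun _ => inferInstance) hz]
      simp only [cauchyTransform, integral_dirac]
      rw [Finset.sum_coe_sort t.range (fun y : ℝ => ((ν (t ⁻¹' {y})).toReal : ℂ) * (z - y)⁻¹)]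
    have hmul : 1 - a * cauchyTransform (ν.map t) z =
        cauchyTransform (ν.map t) z * (Ftransform (ν.map t) z - a) := by
      rw [Ftransform, mul_sub, mul_inv_cancel₀ hG0, mul_comm]
    rw [h z hz _ hG (by rw [hmul]; exact mul_ne_zero hG0 hFa), hmul]
    field_simp
  choose m hm hmG using key
  refine ⟨∑ y ∈ s.range, μ (s ⁻¹' {y}) • m y,
    Finset.isProbabilityMeasure_sum_smul _ _ (sum_one μ s) _ hm, fun z hz => ?_⟩
  rw [cauchyTransform_sum_smul _ _ (sum_one μ s) _ hm hz, SimpleFunc.map_eq_sum_dirac μ,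
    cauchyTransform_sum_smul _ _ (sum_one μ s) _ (fun _ => inferInstance)
      (hz.trans_le (im_le_im_Ftransform (ν.map t) hz))]
  refine Finset.sum_congr rfl fun y _ => ?_
  rw [hmG y z hz, cauchyTransform, integral_dirac]

lemma measure_lt_norm_le_cauchyTransform (α : Measure ℝ) [IsProbabilityMeasure α] {r : ℝ}
    (hr : 0 < r) :
    α {x | r < ‖x‖} ≤
      ENNReal.ofReal (2 * (1 - r * Complex.I * cauchyTransform α (r * Complex.I)).re) := by
  have hz : 0 < ((r : ℂ) * Complex.I).im := by simpa using hr
  have hi : Integrable (fun x : ℝ => 1 - r * Complex.I * (r * Complex.I - (x : ℂ))⁻¹) α :=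
    (integrable_const _).sub ((integrable_inv_sub_ofReal α hz).const_mul _)
  have hre : ∀ x : ℝ, (1 - r * Complex.I * (r * Complex.I - (x : ℂ))⁻¹).re =
      x ^ 2 / (x ^ 2 + r ^ 2) := by
    intro x
    have h : x ^ 2 + r ^ 2 ≠ 0 := by positivity
    have hn : Complex.normSq (r * Complex.I - (x : ℂ)) = x ^ 2 + r ^ 2 := by
      simp [Complex.normSq_apply]
      ring
    simp only [Complex.sub_re, Complex.one_re, Complex.mul_re, Complex.mul_im, Complex.inv_im,
      Complex.inv_re, hn]
    simp
    field_simp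
    ring
  have h1 : ∫ x : ℝ, x ^ 2 / (x ^ 2 + r ^ 2) ∂α =
      (1 - r * Complex.I * cauchyTransform α (r * Complex.I)).re := by
    have h := integral_re (𝕜 := ℂ) hi
    rw [integral_sub (integrable_const _) ((integrable_inv_sub_ofReal α hz).const_mul _),
      integral_const_mul] at h
    simp only [integral_const, probReal_univ, one_smul] at h
    rw [cauchyTransform]
    refine Eq.trans ?_ h
    exact integral_congr_ae (ae_of_all _ fun x => (hre x).symm)
  have hi2 : Integrable (fun x : ℝ => x ^ 2 / (x ^ 2 + r ^ 2)) α :=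
    hi.re.congr (ae_of_all _ hre)
  have h2 := mul_meas_ge_le_integral_of_nonneg
    (ae_of_all α fun x : ℝ => (by positivity : 0 ≤ x ^ 2 / (x ^ 2 + r ^ 2))) hi2 (1 / 2)
  have hsub : {x : ℝ | r < ‖x‖} ⊆ {x | 1 / 2 ≤ x ^ 2 / (x ^ 2 + r ^ 2)} := by
    intro x hx
    have hx' : r ^ 2 ≤ x ^ 2 := sq_le_sq.2 (by rw [abs_of_pos hr]; exact le_of_lt hx)
    change 1 / 2 ≤ x ^ 2 / (x ^ 2 + r ^ 2)
    rw [div_le_div_iff₀ two_pos (by positivity)]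
    linarith
  rw [h1] at h2
  refine (measure_mono hsub).trans ((ENNReal.le_ofReal_iff_toReal_le (measure_ne_top _ _) ?_).2 ?_)
  · have := measureReal_nonneg (μ := α) (s := {x : ℝ | 1 / 2 ≤ x ^ 2 / (x ^ 2 + r ^ 2)})
    linarith
  · change α.real _ ≤ _
    linarith

theorem exists_cauchyTransform_eq_of_tendsto (α : ℕ → Measure ℝ) [∀ n, IsProbabilityMeasure (α n)]
    (H : ℂ → ℂ)
    (hH : ∀ z : ℂ, 0 < z.im → Tendsto (fun n => cauchyTransform (α n) z) atTop (𝓝 (H z)))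
    (hlim : Tendsto (fun y : ℝ => y * Complex.I * H (y * Complex.I)) atTop (𝓝 1)) :
    ∃ β : Measure ℝ, IsProbabilityMeasure β ∧ ∀ z : ℂ, 0 < z.im → cauchyTransform β z = H z := by
  have htight : IsTightMeasureSet (range α) := by
    refine isTightMeasureSet_range_of_tendsto_limsup_measure_norm_gt ?_
    have h0 : Tendsto (fun r : ℝ =>
        ENNReal.ofReal (2 * (1 - r * Complex.I * H (r * Complex.I)).re)) atTop (𝓝 0) := by
      have h := (Complex.continuous_re.tendsto _).comp ((tendsto_const_nhds (x := (1 : ℂ))).sub hlim)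
      have := ENNReal.tendsto_ofReal (h.const_mul 2)
      simpa using this
    refine tendsto_of_tendsto_of_tendsto_of_le_of_le' tendsto_const_nhds h0
      (Eventually.of_forall fun _ => zero_le) ?_
    filter_upwards [eventually_gt_atTop 0] with r hr
    have hz : 0 < ((r : ℂ) * Complex.I).im := by simpa using hr
    have h1 : Tendsto (fun n => ENNReal.ofReal
        (2 * (1 - r * Complex.I * cauchyTransform (α n) (r * Complex.I)).re)) atTop
        (𝓝 (ENNReal.ofReal (2 * (1 - r * Complex.I * H (r * Complex.I)).re))) :=
      ENNReal.tendsto_ofReal (((Complex.continuous_re.tendsto _).comp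
        (tendsto_const_nhds.sub ((hH _ hz).const_mul _))).const_mul 2)
    rw [← h1.limsup_eq]
    exact limsup_le_limsup (Eventually.of_forall fun n => measure_lt_norm_le_cauchyTransform (α n) hr)
  let P : ℕ → ProbabilityMeasure ℝ := fun n => ⟨α n, inferInstance⟩
  have hset : {((m : ProbabilityMeasure ℝ) : Measure ℝ) | m ∈ range P} = range α := by
    ext m
    constructor
    · rintro ⟨_, ⟨n, rfl⟩, rfl⟩
      exact ⟨n, rfl⟩
    · rintro ⟨n, rfl⟩
      exact ⟨P n, ⟨n, rfl⟩, rfl⟩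
  have hcomp : IsCompact (closure (range P)) :=
    isCompact_closure_of_isTightMeasureSet (by rw [hset]; exact htight)
  let U : Ultrafilter ℕ := Ultrafilter.of atTop
  have hU : (U : Filter ℕ) ≤ atTop := Ultrafilter.of_le atTop
  obtain ⟨β, -, hβ⟩ := hcomp.ultrafilter_le_nhds (U.map P) (by
    rw [le_principal_iff]
    exact Filter.mem_map.2 (Filter.univ_mem' fun n => subset_closure (mem_range_self n)))
  have hβ' : Tendsto P U (𝓝 β) := hβ
  rw [ProbabilityMeasure.tendsto_iff_forall_integral_rclike_tendsto ℂ] at hβ'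
  refine ⟨β, inferInstance, fun z hz => ?_⟩
  have h2 := hβ' (BoundedContinuousFunction.ofNormedAddCommGroup (fun x : ℝ => (z - (x : ℂ))⁻¹)
    (continuous_inv_sub_ofReal hz) z.im⁻¹ (norm_inv_sub_ofReal_le hz le_rfl))
  exact tendsto_nhds_unique h2 ((hH z hz).mono_left hU)

theorem exists_cauchyTransform_eq_comp_Ftransform (μ ν : Measure ℝ) [IsProbabilityMeasure μ]
    [IsProbabilityMeasure ν] :
    ∃ α : Measure ℝ, IsProbabilityMeasure α ∧ ∀ z : ℂ, 0 < z.im →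
      cauchyTransform α z = cauchyTransform μ (Ftransform ν z) := by
  have hid : StronglyMeasurable (id : ℝ → ℝ) := stronglyMeasurable_id
  have hmap : ∀ (ρ : Measure ℝ) n w, cauchyTransform (ρ.map (hid.approx n)) w =
      ∫ x, (w - (hid.approx n x : ℂ))⁻¹ ∂ρ := fun ρ n w =>
    integral_map (hid.approx n).measurable.aemeasurable
      (Measurable.aestronglyMeasurable (by fun_prop))
  choose α hα hαG using fun n =>
    exists_cauchyTransform_eq_comp_of_simpleFunc μ ν (hid.approx n) (hid.approx n)
  refine exists_cauchyTransform_eq_of_tendsto α (fun z => cauchyTransform μ (Ftransform ν z)) ?_ ?_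
  · intro z hz
    simp_rw [hαG _ z hz, hmap]
    refine tendsto_integral_inv_sub (fun n => (hid.approx n).measurable) hid.tendsto_approx
      (hz.trans_le (im_le_im_Ftransform ν hz)) ?_
    simp_rw [Ftransform, hmap]
    exact (tendsto_integral_inv_sub (fun n => (hid.approx n).measurable) hid.tendsto_approx hz
      tendsto_const_nhds).inv₀ (cauchyTransform_ne_zero ν hz)
  · refine tendsto_mul_I_mul_cauchyTransform μ (w := fun y => Ftransform ν (y * Complex.I)) ?_
      (tendsto_Ftransform_div ν)
    intro y hy
    have := im_le_im_Ftransform ν (z := y * Complex.I) (by simpa using hy)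
    simpa using this

lemma integral_integral_comp_add_mul_eq (α : Measure ℝ) [IsProbabilityMeasure α]
    (f : BoundedContinuousFunction ℝ ℝ) {ε : ℝ} (hε : 0 < ε) :
    ∫ x, (∫ u : ℝ, f (x + ε * u) * (1 + u ^ 2)⁻¹) ∂α =
      ∫ t : ℝ, f t * -(cauchyTransform α (t + ε * Complex.I)).im := by
  let ψ : ℝ → ℝ := fun u => ε⁻¹ * (1 + (ε⁻¹ * u) ^ 2)⁻¹
  have hψ : Integrable ψ :=
    (integrable_inv_one_add_sq.comp_mul_left' (inv_ne_zero hε.ne')).const_mul _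
  have hinner : ∀ x, ∫ u : ℝ, f (x + ε * u) * (1 + u ^ 2)⁻¹ = ∫ t, f t * ψ (t - x) := by
    intro x
    rw [← integral_add_left_eq_self (fun t => f t * ψ (t - x)) x]
    have h := Measure.integral_comp_mul_left (fun t => f (x + t) * ψ (x + t - x)) ε
    have hε' : ε * |ε⁻¹| = 1 := by rw [abs_of_pos (inv_pos.2 hε), mul_inv_cancel₀ hε.ne']
    have h' : ∫ t, f (x + t) * ψ (x + t - x) =
        ε * ∫ u, f (x + ε * u) * ψ (x + ε * u - x) := by
      rw [h, smul_eq_mul, ← mul_assoc, hε', one_mul]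
    rw [h', ← integral_const_mul]
    refine integral_congr_ae (ae_of_all _ fun u => ?_)
    simp only [ψ, add_sub_cancel_left, inv_mul_cancel_left₀ hε.ne']
    field_simp
  have hprod : Integrable (fun p : ℝ × ℝ => f p.1 * ψ (p.1 - p.2)) (volume.prod α) := by
    have h := Integrable.convolution_integrand (ContinuousLinearMap.mul ℝ ℝ)
      (integrable_const (μ := α) (1 : ℝ)) hψ
    simp only [ContinuousLinearMap.mul_apply', one_mul] at h
    exact h.bdd_mul (c := ‖f‖) (by fun_prop) (ae_of_all _ fun p => f.norm_coe_le_norm _)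
  simp_rw [hinner]
  rw [← integral_integral_swap hprod]
  refine integral_congr_ae (ae_of_all _ fun t => ?_)
  simp only
  rw [integral_const_mul, im_cauchyTransform α (by simpa using hε), neg_neg]
  congr 1
  rw [← integral_const_mul]
  refine integral_congr_ae (ae_of_all _ fun x => ?_)
  have hn : ‖((t : ℂ) + ε * Complex.I - x)⁻¹‖ ^ 2 = ((t - x) ^ 2 + ε ^ 2)⁻¹ := by
    rw [norm_inv, inv_pow, ← Complex.normSq_eq_norm_sq]
    simp [Complex.normSq_apply]
    ring
  simp only [hn, ψ]
  simp
  field_simp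
  ring

lemma tendsto_integral_integral_comp_add_mul (α : Measure ℝ) [IsProbabilityMeasure α]
    (f : BoundedContinuousFunction ℝ ℝ) :
    Tendsto (fun ε : ℝ => ∫ x, (∫ u : ℝ, f (x + ε * u) * (1 + u ^ 2)⁻¹) ∂α) (𝓝[>] 0)
      (𝓝 (Real.pi * ∫ x, f x ∂α)) := by
  have hbound : ∀ ε x u : ℝ, ‖f (x + ε * u) * (1 + u ^ 2)⁻¹‖ ≤ ‖f‖ * (1 + u ^ 2)⁻¹ := by
    intro ε x u
    rw [norm_mul, Real.norm_of_nonneg (by positivity : 0 ≤ (1 + u ^ 2)⁻¹)]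
    gcongr
    exact f.norm_coe_le_norm _
  have hint := integrable_inv_one_add_sq.const_mul ‖f‖
  rw [← integral_const_mul]
  refine tendsto_integral_filter_of_dominated_convergence
    (fun _ => ∫ u : ℝ, ‖f‖ * (1 + u ^ 2)⁻¹) ?_ ?_ (integrable_const _) ?_
  · refine Eventually.of_forall fun ε => Continuous.aestronglyMeasurable ?_
    refine continuous_of_dominated (bound := fun u => ‖f‖ * (1 + u ^ 2)⁻¹) ?_ ?_ hint ?_
    · exact fun x => Measurable.aestronglyMeasurable (by fun_prop)
    · exact fun x => ae_of_all _ (hbound ε x)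
    · exact ae_of_all _ fun u => by fun_prop
  · exact Eventually.of_forall fun ε => ae_of_all _ fun x =>
      norm_integral_le_of_norm_le hint (ae_of_all _ (hbound ε x))
  · refine ae_of_all _ fun x => ?_
    have hx : Real.pi * f x = ∫ u : ℝ, f (x + 0 * u) * (1 + u ^ 2)⁻¹ := by
      simp only [zero_mul, add_zero]
      rw [integral_const_mul, integral_univ_inv_one_add_sq, mul_comm]
    rw [hx]
    refine (Continuous.tendsto ?_ 0).mono_left nhdsWithin_le_nhds
    refine continuous_of_dominated (bound := fun u => ‖f‖ * (1 + u ^ 2)⁻¹) ?_ ?_ hint ?_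
    · exact fun ε => Measurable.aestronglyMeasurable (by fun_prop)
    · exact fun ε => ae_of_all _ (hbound ε x)
    · exact ae_of_all _ fun u => by fun_prop

theorem ext_of_cauchyTransform_eq (α β : Measure ℝ) [IsProbabilityMeasure α]
    [IsProbabilityMeasure β]
    (h : ∀ z : ℂ, 0 < z.im → cauchyTransform α z = cauchyTransform β z) : α = β := by
  refine ext_of_forall_integral_eq_of_IsFiniteMeasure fun f => ?_
  have hlim := tendsto_nhds_unique ((tendsto_integral_integral_comp_add_mul α f).congr' ?_)
    (tendsto_integral_integral_comp_add_mul β f)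
  · exact mul_left_cancel₀ Real.pi_ne_zero hlim
  · filter_upwards [self_mem_nhdsWithin] with ε hε
    rw [integral_integral_comp_add_mul_eq α f hε, integral_integral_comp_add_mul_eq β f hε]
    refine integral_congr_ae (ae_of_all _ fun t => ?_)
    simp only [h (t + ε * Complex.I) (by simpa using hε)]

/-- The monotone convolution is well defined: for probability measures μ, ν on ℝ,
there is a unique probability measure α with `F_α = F_μ ∘ F_ν` on the upper half-plane. -/
theorem monotone_convolution_wellDefined
    (μ ν : Measure ℝ) [IsProbabilityMeasure μ] [IsProbabilityMeasure ν] :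
    ∃! α : Measure ℝ, IsProbabilityMeasure α ∧
      ∀ z : ℂ, 0 < z.im → Ftransform α z = Ftransform μ (Ftransform ν z) := by
  obtain ⟨α, hα, h⟩ := exists_cauchyTransform_eq_comp_Ftransform μ ν
  refine ⟨α, ⟨hα, fun z hz => congrArg (·⁻¹) (h z hz)⟩, fun β ⟨hβ, hβF⟩ => ?_⟩
  refine ext_of_cauchyTransform_eq β α fun z hz => ?_
  rw [h z hz]
  exact inv_injective (hβF z hz)
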